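/- arXiv:1812.08759 — 7 statements merged into one kernel-verified Lean document; each statement's English description precedes it below -/
import Mathlib

section
/- Let t0 < T, K > 0, ω > 0, and z0, zT ∈ ℝ². Let z*(t) = (zT · sinh(ω(t − t0)) + z0 · sinh(ω(T − t))) / sinh(ω(T − t0)). Then the total cost ∫_{t0}^{T} [ (K/2)‖z*'(t)‖² + (Kω²/2)‖z*(t)‖² ] dt equals (Kω / (2 sinh(ω(T − t0)))) · ( (‖z0‖² + ‖zT‖²) cosh(ω(T − t0)) − 2⟨z0, zT⟩ ). -/
open Real
open scoped RealInnerProductSpace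

/-- If `z'' = c ^ 2 z`, then `⟪z, z'⟫` is a primitive of `‖z'‖ ^ 2 + c ^ 2 ‖z‖ ^ 2`. -/
theorem integral_norm_deriv_sq_add_norm_sq {E : Type*} [NormedAddCommGroup E]
    [InnerProductSpace ℝ E] {z v : ℝ → E} {c : ℝ} (hz : ∀ t, HasDerivAt z (v t) t)
    (hv : ∀ t, HasDerivAt v (c ^ 2 • z t) t) (k a b : ℝ) :
    ∫ t in a..b, (k / 2 * ‖deriv z t‖ ^ 2 + k * c ^ 2 / 2 * ‖z t‖ ^ 2) =
      k / 2 * (inner ℝ (z b) (v b) - inner ℝ (z a) (v a)) := by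
  have hz_cont : Continuous z := continuous_iff_continuousAt.2 fun t => (hz t).continuousAt
  have hv_cont : Continuous v := continuous_iff_continuousAt.2 fun t => (hv t).continuousAt
  have hderiv : deriv z = v := funext fun t => (hz t).deriv
  rw [hderiv, mul_sub]
  refine intervalIntegral.integral_eq_sub_of_hasDerivAt
    (f := fun t => k / 2 * inner ℝ (z t) (v t)) (fun t _ => ?_)
    (Continuous.intervalIntegrable (by fun_prop) _ _)
  refine (((hz t).inner ℝ (hv t)).const_mul (k / 2)).congr_deriv ?_
  rw [real_inner_smul_right, real_inner_self_eq_norm_sq, real_inner_self_eq_norm_sq]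
  ring

/-- Closed form of the action (total cost) along the single-phase hot
spot optimal trajectory:
`∫_{t0}^{T} (K/2)‖z*'‖² + (Kω²/2)‖z*‖² dt
  = (Kω / (2 sinh(ω(T−t0)))) ((‖z0‖² + ‖zT‖²) cosh(ω(T−t0)) − 2⟨z0, zT⟩)`. -/
theorem single_phase_hotspot_action_closed_form
    (t0 T K ω : ℝ) (ht : t0 < T) (hK : 0 < K) (hω : 0 < ω)
    (z0 zT : EuclideanSpace ℝ (Fin 2))
    (zstar : ℝ → EuclideanSpace ℝ (Fin 2))
    (hzstar : zstar = fun t =>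
      (Real.sinh (ω * (T - t0)))⁻¹ •
        (Real.sinh (ω * (t - t0)) • zT + Real.sinh (ω * (T - t)) • z0)) :
    ∫ t in t0..T,
        (K / 2 * ‖deriv zstar t‖ ^ 2 + K * ω ^ 2 / 2 * ‖zstar t‖ ^ 2) =
      K * ω / (2 * Real.sinh (ω * (T - t0))) *
        ((‖z0‖ ^ 2 + ‖zT‖ ^ 2) * Real.cosh (ω * (T - t0)) - 2 * ⟪z0, zT⟫) := by
  have hs : Real.sinh (ω * (T - t0)) ≠ 0 :=
    (Real.sinh_pos_iff.2 (mul_pos hω (sub_pos.2 ht))).ne'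
  have hl (t : ℝ) : HasDerivAt (fun t => ω * (t - t0)) ω t := by
    simpa using ((hasDerivAt_id t).sub_const t0).const_mul ω
  have hr (t : ℝ) : HasDerivAt (fun t => ω * (T - t)) (-ω) t := by
    simpa using ((hasDerivAt_id t).const_sub T).const_mul ω
  have hz (t : ℝ) : HasDerivAt zstar ((Real.sinh (ω * (T - t0)))⁻¹ •
      ((Real.cosh (ω * (t - t0)) * ω) • zT + (Real.cosh (ω * (T - t)) * -ω) • z0)) t := by
    rw [hzstar]
    exact (((hl t).sinh.smul_const zT).add ((hr t).sinh.smul_const z0)).const_smul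
      (Real.sinh (ω * (T - t0)))⁻¹
  have hv (t : ℝ) : HasDerivAt (fun t => (Real.sinh (ω * (T - t0)))⁻¹ •
      ((Real.cosh (ω * (t - t0)) * ω) • zT + (Real.cosh (ω * (T - t)) * -ω) • z0))
      (ω ^ 2 • zstar t) t := by
    refine (((((hl t).cosh.mul_const ω).smul_const zT).add
      (((hr t).cosh.mul_const (-ω)).smul_const z0)).const_smul
        (Real.sinh (ω * (T - t0)))⁻¹).congr_deriv ?_
    rw [hzstar]
    module
  have hT : zstar T = zT := by simp [hzstar, smul_smul, hs]
  have h0 : zstar t0 = z0 := by simp [hzstar, smul_smul, hs]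
  rw [integral_norm_deriv_sq_add_norm_sq hz hv, hT, h0]
  simp only [sub_self, mul_zero, Real.cosh_zero, real_inner_smul_right, inner_add_right,
    real_inner_self_eq_norm_sq, real_inner_comm z0 zT]
  field_simp
  ring
end

section
/- Let t0 < T, K > 0, ω > 0, and z0, zT ∈ ℝ². Let z*(t) = (zT · sinh(ω(t − t0)) + z0 · sinh(ω(T − t))) / sinh(ω(T − t0)). Then for every continuously differentiable curve z : [t0, T] → ℝ² with z(t0) = z0 and z(T) = zT, one has ∫_{t0}^{T} [ (K/2)‖z*'(t)‖² + (Kω²/2)‖z*(t)‖² ] dt ≤ ∫_{t0}^{T} [ (K/2)‖z'(t)‖² + (Kω²/2)‖z(t)‖² ] dt; that is, z* minimizes the action among all admissible trajectories with the same endpoints. -/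
open Real

/-- The tangent-line inequality for the convex function `‖·‖ ^ 2 / 2`. -/
lemma half_norm_sq_add_inner_sub_le {E : Type*} [NormedAddCommGroup E] [InnerProductSpace ℝ E]
    (a b : E) : ‖a‖ ^ 2 / 2 + inner ℝ a (b - a) ≤ ‖b‖ ^ 2 / 2 := by
  have h := norm_sub_sq_real b a
  rw [inner_sub_right, real_inner_self_eq_norm_sq, real_inner_comm]
  nlinarith [sq_nonneg ‖b - a‖]

/-- A solution of `x'' = ω² x` minimizes the action `∫ (K/2)‖z'‖² + (Kω²/2)‖z‖²` among the
continuously differentiable curves with the same endpoints. -/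
lemma integral_action_le_of_hasDerivAt {E : Type*} [NormedAddCommGroup E] [InnerProductSpace ℝ E]
    {a b K ω : ℝ} (hab : a < b) (hK : 0 ≤ K) {x v z : ℝ → E}
    (hx : ∀ t, HasDerivAt x (v t) t) (hv : ∀ t, HasDerivAt v (ω ^ 2 • x t) t)
    (hz : ContDiffOn ℝ 1 z (Set.Icc a b)) (hza : z a = x a) (hzb : z b = x b) :
    (∫ t in a..b, (K / 2 * ‖v t‖ ^ 2 + K * ω ^ 2 / 2 * ‖x t‖ ^ 2)) ≤
      ∫ t in a..b,
        (K / 2 * ‖derivWithin z (Set.Icc a b) t‖ ^ 2 + K * ω ^ 2 / 2 * ‖z t‖ ^ 2) := by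
  set z' := derivWithin z (Set.Icc a b)
  have hxc : Continuous x := continuous_iff_continuousAt.2 fun t => (hx t).continuousAt
  have hvc : Continuous v := continuous_iff_continuousAt.2 fun t => (hv t).continuousAt
  have hzc : ContinuousOn z (Set.Icc a b) := hz.continuousOn
  have hzc' : ContinuousOn z' (Set.Icc a b) :=
    hz.continuousOn_derivWithin (uniqueDiffOn_Icc hab) le_rfl
  have hz' : ∀ t ∈ Set.Ioo a b, HasDerivAt z (z' t) t := fun t ht =>
    ((hz.differentiableOn one_ne_zero t
      (Set.Ioo_subset_Icc_self ht)).hasDerivWithinAt).hasDerivAt (Icc_mem_nhds ht.1 ht.2)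
  let G' : ℝ → ℝ := fun t => inner ℝ (v t) (z' t - v t) + inner ℝ (ω ^ 2 • x t) (z t - x t)
  have hGc' : ContinuousOn G' (Set.Icc a b) :=
    (hvc.continuousOn.inner (hzc'.sub hvc.continuousOn)).add
      ((hxc.continuousOn.const_smul _).inner (hzc.sub hxc.continuousOn))
  have hGi : IntervalIntegrable G' MeasureTheory.volume a b :=
    hGc'.intervalIntegrable_of_Icc hab.le
  have hG : ∫ t in a..b, G' t = 0 := by
    rw [intervalIntegral.integral_eq_sub_of_hasDerivAt_of_le hab.le
      (f := fun t => inner ℝ (v t) (z t - x t))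
      (hvc.continuousOn.inner (hzc.sub hxc.continuousOn))
      (fun t ht => (hv t).inner ℝ ((hz' t ht).sub (hx t))) hGi]
    simp [hza, hzb]
  have hLx : IntervalIntegrable
      (fun t => K / 2 * ‖v t‖ ^ 2 + K * ω ^ 2 / 2 * ‖x t‖ ^ 2) MeasureTheory.volume a b :=
    Continuous.intervalIntegrable (by fun_prop) _ _
  have hLz : IntervalIntegrable
      (fun t => K / 2 * ‖z' t‖ ^ 2 + K * ω ^ 2 / 2 * ‖z t‖ ^ 2) MeasureTheory.volume a b :=
    ContinuousOn.intervalIntegrable_of_Icc hab.le (by fun_prop)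
  calc _ = ∫ t in a..b, (K / 2 * ‖v t‖ ^ 2 + K * ω ^ 2 / 2 * ‖x t‖ ^ 2 + K * G' t) := by
        rw [intervalIntegral.integral_add hLx (hGi.const_mul K),
          intervalIntegral.integral_const_mul, hG, mul_zero, add_zero]
    _ ≤ _ := by
        refine intervalIntegral.integral_mono_on hab.le (hLx.add (hGi.const_mul K)) hLz ?_
        intro t _
        have h₁ := mul_le_mul_of_nonneg_left (half_norm_sq_add_inner_sub_le (v t) (z' t)) hK
        have h₂ := mul_le_mul_of_nonneg_left (half_norm_sq_add_inner_sub_le (x t) (z t))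
          (mul_nonneg hK (sq_nonneg ω))
        simp only [G', real_inner_smul_left]
        linarith

/-- Global optimality of the hyperbolic trajectory in the hot spot case:
among all continuously differentiable curves on `[t0, T]` with the same endpoints,
`z*` minimizes the action `∫ (K/2)‖z'‖² + (Kω²/2)‖z‖² dt`. -/
theorem single_phase_hotspot_trajectory_minimizes_action
    (t0 T K ω : ℝ) (ht : t0 < T) (hK : 0 < K) (hω : 0 < ω)
    (z0 zT : EuclideanSpace ℝ (Fin 2))
    (zstar : ℝ → EuclideanSpace ℝ (Fin 2))
    (hzstar : zstar = fun t =>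
      (Real.sinh (ω * (T - t0)))⁻¹ •
        (Real.sinh (ω * (t - t0)) • zT + Real.sinh (ω * (T - t)) • z0)) :
    ∀ z : ℝ → EuclideanSpace ℝ (Fin 2),
      ContDiffOn ℝ 1 z (Set.Icc t0 T) → z t0 = z0 → z T = zT →
      (∫ t in t0..T,
          (K / 2 * ‖deriv zstar t‖ ^ 2 + K * ω ^ 2 / 2 * ‖zstar t‖ ^ 2)) ≤
        ∫ t in t0..T,
          (K / 2 * ‖derivWithin z (Set.Icc t0 T) t‖ ^ 2 + K * ω ^ 2 / 2 * ‖z t‖ ^ 2) := by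
  intro z hz hza hzb
  have hs : Real.sinh (ω * (T - t0)) ≠ 0 :=
    (Real.sinh_pos_iff.2 (mul_pos hω (sub_pos.2 ht))).ne'
  let v : ℝ → EuclideanSpace ℝ (Fin 2) := fun t =>
    (Real.sinh (ω * (T - t0)))⁻¹ •
      ((Real.cosh (ω * (t - t0)) * ω) • zT + (Real.cosh (ω * (T - t)) * -ω) • z0)
  have hl : ∀ t, HasDerivAt (fun t => ω * (t - t0)) ω t := fun t => by
    simpa using ((hasDerivAt_id t).sub_const t0).const_mul ω
  have hr : ∀ t, HasDerivAt (fun t => ω * (T - t)) (-ω) t := fun t => by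
    simpa using ((hasDerivAt_id t).const_sub T).const_mul ω
  have hx : ∀ t, HasDerivAt zstar (v t) t := fun t => by
    rw [hzstar]
    exact (((hl t).sinh.smul_const zT).add ((hr t).sinh.smul_const z0)).const_smul
      (Real.sinh (ω * (T - t0)))⁻¹
  have hv : ∀ t, HasDerivAt v (ω ^ 2 • zstar t) t := fun t => by
    have h := (((((hl t).cosh.mul_const ω).smul_const zT).add
      (((hr t).cosh.mul_const (-ω)).smul_const z0)).const_smul (Real.sinh (ω * (T - t0)))⁻¹)
    refine h.congr_deriv ?_
    rw [hzstar]
    module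
  rw [funext fun t => (hx t).deriv]
  exact integral_action_le_of_hasDerivAt ht hK.le hx hv hz
    (by simp [hza, hzstar, hs]) (by simp [hzb, hzstar, hs])
end

section
/- Let t0 < T, K > 0, ω > 0 with sin(ω(T − t0)) ≠ 0, and z0, zT ∈ ℝ². Let z*(t) = (zT · sin(ω(t − t0)) + z0 · sin(ω(T − t))) / sin(ω(T − t0)). Then ∫_{t0}^{T} [ (K/2)‖z*'(t)‖² − (Kω²/2)‖z*(t)‖² ] dt equals (Kω / (2 sin(ω(T − t0)))) · ( (‖z0‖² + ‖zT‖²) cos(ω(T − t0)) − 2⟨z0, zT⟩ ). -/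
open Real
open scoped RealInnerProductSpace

/-- The velocity of the curve
`t ↦ (sin (ω (T - t0)))⁻¹ • (sin (ω (t - t0)) • zT + sin (ω (T - t)) • z0)`. -/
theorem hasDerivAt_smul_sin_add_sin {E : Type*} [NormedAddCommGroup E] [NormedSpace ℝ E]
    (c t0 T ω : ℝ) (x y : E) (t : ℝ) :
    HasDerivAt (fun t => c • (Real.sin (ω * (t - t0)) • y + Real.sin (ω * (T - t)) • x))
      ((c * ω) • (Real.cos (ω * (t - t0)) • y - Real.cos (ω * (T - t)) • x)) t := by
  have h1 := (((hasDerivAt_id t).sub_const t0).const_mul ω).sin.smul_const y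
  have h2 := (((hasDerivAt_id t).const_sub T).const_mul ω).sin.smul_const x
  refine ((h1.add h2).const_smul c).congr_deriv ?_
  simp only [id]
  module

/-- The acceleration of the same curve, in terms of its position. -/
theorem hasDerivAt_smul_cos_sub_cos {E : Type*} [NormedAddCommGroup E] [NormedSpace ℝ E]
    (c t0 T ω : ℝ) (x y : E) (t : ℝ) :
    HasDerivAt (fun t => (c * ω) • (Real.cos (ω * (t - t0)) • y - Real.cos (ω * (T - t)) • x))
      (-ω ^ 2 • (c • (Real.sin (ω * (t - t0)) • y + Real.sin (ω * (T - t)) • x))) t := by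
  have h1 := (((hasDerivAt_id t).sub_const t0).const_mul ω).cos.smul_const y
  have h2 := (((hasDerivAt_id t).const_sub T).const_mul ω).cos.smul_const x
  refine ((h1.sub h2).const_smul (c * ω)).congr_deriv ?_
  simp only [id]
  module

/-- Closed form of the action (total cost) along the single-phase traffic
hole optimal trajectory:
`∫_{t0}^{T} (K/2)‖z*'‖² − (Kω²/2)‖z*‖² dt
  = (Kω / (2 sin(ω(T−t0)))) ((‖z0‖² + ‖zT‖²) cos(ω(T−t0)) − 2⟨z0, zT⟩)`. -/
theorem single_phase_hole_action_closed_form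
    (t0 T K ω : ℝ) (ht : t0 < T) (hK : 0 < K) (hω : 0 < ω)
    (hsin : Real.sin (ω * (T - t0)) ≠ 0)
    (z0 zT : EuclideanSpace ℝ (Fin 2))
    (zstar : ℝ → EuclideanSpace ℝ (Fin 2))
    (hzstar : zstar = fun t =>
      (Real.sin (ω * (T - t0)))⁻¹ •
        (Real.sin (ω * (t - t0)) • zT + Real.sin (ω * (T - t)) • z0)) :
    ∫ t in t0..T,
        (K / 2 * ‖deriv zstar t‖ ^ 2 - K * ω ^ 2 / 2 * ‖zstar t‖ ^ 2) =
      K * ω / (2 * Real.sin (ω * (T - t0))) *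
        ((‖z0‖ ^ 2 + ‖zT‖ ^ 2) * Real.cos (ω * (T - t0)) - 2 * ⟪z0, zT⟫) := by
  set S := Real.sin (ω * (T - t0)) with hS
  set v : ℝ → EuclideanSpace ℝ (Fin 2) := fun t =>
    (S⁻¹ * ω) • (Real.cos (ω * (t - t0)) • zT - Real.cos (ω * (T - t)) • z0) with hv
  have hz : ∀ t, HasDerivAt zstar (v t) t := fun t => by
    rw [hzstar]
    exact hasDerivAt_smul_sin_add_sin S⁻¹ t0 T ω z0 zT t
  have hv' : ∀ t, HasDerivAt v (-ω ^ 2 • zstar t) t := fun t => by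
    rw [hzstar]
    exact hasDerivAt_smul_cos_sub_cos S⁻¹ t0 T ω z0 zT t
  have hderiv : deriv zstar = v := funext fun t => (hz t).deriv
  have hzc : Continuous zstar := continuous_iff_continuousAt.2 fun t => (hz t).continuousAt
  have hvc : Continuous v := continuous_iff_continuousAt.2 fun t => (hv' t).continuousAt
  have hF : ∀ t, HasDerivAt (fun t => K / 2 * ⟪zstar t, v t⟫)
      (K / 2 * ‖v t‖ ^ 2 - K * ω ^ 2 / 2 * ‖zstar t‖ ^ 2) t := fun t => by
    refine (((hz t).inner ℝ (hv' t)).const_mul (K / 2)).congr_deriv ?_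
    rw [real_inner_smul_right, real_inner_self_eq_norm_sq, real_inner_self_eq_norm_sq]
    ring
  have hzT : zstar T = zT := by simp [hzstar, ← hS, smul_smul, hsin]
  have hz0 : zstar t0 = z0 := by simp [hzstar, ← hS, smul_smul, hsin]
  rw [hderiv, intervalIntegral.integral_eq_sub_of_hasDerivAt (fun t _ => hF t)
    (Continuous.intervalIntegrable (by fun_prop) _ _), hzT, hz0]
  simp only [hv, sub_self, mul_zero, Real.cos_zero, one_smul, real_inner_smul_right,
    inner_sub_right, real_inner_self_eq_norm_sq, real_inner_comm z0 zT]
  field_simp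
  ring
end

section
/- Let t0 < T, K > 0, u0 < 0 with ω² = −u0/K, u1 ∈ ℝ, e ∈ ℝ², and z0, zT ∈ ℝ². Consider the traffic intensity u(z) = (u0/2)‖z‖² + u0⟨z, e⟩ + u1 and define z̃0 = z0 + e, z̃T = zT + e, and z*(t) = (z̃T · sinh(ω(t − t0)) + z̃0 · sinh(ω(T − t))) / sinh(ω(T − t0)) − e. Then z* is twice continuously differentiable, z*(t0) = z0, z*(T) = zT, and K z*''(t) = −∇u(z*(t)) = −u0 (z*(t) + e) for all t ∈ [t0, T]; i.e., z* satisfies the Euler–Lagrange equation for the Lagrangian L(z, a) = (K/2)‖a‖² − u(z) with the prescribed endpoints. -/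
open Real
open scoped RealInnerProductSpace

section HyperbolicInterpolation

variable {E : Type*} [NormedAddCommGroup E] [NormedSpace ℝ E]

theorem contDiff_sinh_interpolation {n : WithTop ℕ∞} (ω t0 T c : ℝ) (a b e : E) :
    ContDiff ℝ n fun t : ℝ =>
      c • (Real.sinh (ω * (t - t0)) • b + Real.sinh (ω * (T - t)) • a) - e := by
  fun_prop

theorem hasDerivAt_sinh_interpolation (ω t0 T c : ℝ) (a b e : E) (t : ℝ) :
    HasDerivAt
      (fun t : ℝ => c • (Real.sinh (ω * (t - t0)) • b + Real.sinh (ω * (T - t)) • a) - e)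
      (c • ((ω * Real.cosh (ω * (t - t0))) • b - (ω * Real.cosh (ω * (T - t))) • a)) t := by
  have hb := (((hasDerivAt_id' t).sub_const t0).const_mul ω).sinh.smul_const b
  have ha := (((hasDerivAt_id' t).const_sub T).const_mul ω).sinh.smul_const a
  exact (((hb.add ha).const_smul c).sub_const e).congr_deriv (by module)

theorem hasDerivAt_cosh_interpolation (ω t0 T c : ℝ) (a b : E) (t : ℝ) :
    HasDerivAt
      (fun t : ℝ => c • ((ω * Real.cosh (ω * (t - t0))) • b - (ω * Real.cosh (ω * (T - t))) • a))
      (ω ^ 2 • (c • (Real.sinh (ω * (t - t0)) • b + Real.sinh (ω * (T - t)) • a))) t := by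
  have hb := ((((hasDerivAt_id' t).sub_const t0).const_mul ω).cosh.const_mul ω).smul_const b
  have ha := ((((hasDerivAt_id' t).const_sub T).const_mul ω).cosh.const_mul ω).smul_const a
  exact ((hb.sub ha).const_smul c).congr_deriv (by module)

theorem deriv_deriv_sinh_interpolation (ω t0 T c : ℝ) (a b e : E) (t : ℝ) :
    deriv (deriv fun t : ℝ =>
      c • (Real.sinh (ω * (t - t0)) • b + Real.sinh (ω * (T - t)) • a) - e) t =
      ω ^ 2 • (c • (Real.sinh (ω * (t - t0)) • b + Real.sinh (ω * (T - t)) • a)) := by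
  rw [funext fun s => (hasDerivAt_sinh_interpolation ω t0 T c a b e s).deriv]
  exact (hasDerivAt_cosh_interpolation ω t0 T c a b t).deriv

end HyperbolicInterpolation

theorem hasGradientAt_quadratic_add_linear {F : Type*} [NormedAddCommGroup F]
    [InnerProductSpace ℝ F] [CompleteSpace F] (k c : ℝ) (e x : F) :
    HasGradientAt (fun w : F => k / 2 * ‖w‖ ^ 2 + k * ⟪w, e⟫ + c) (k • (x + e)) x := by
  rw [hasGradientAt_iff_hasFDerivAt]
  have hq := ((hasStrictFDerivAt_norm_sq x).hasFDerivAt).const_mul (k / 2)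
  have hl := ((hasFDerivAt_id x).inner ℝ (hasFDerivAt_const e x)).const_mul k
  refine ((hq.add hl).add_const c).congr_fderiv ?_
  ext y
  simp [real_inner_comm]
  ring

/-- Corollary 1: for the traffic intensity
`u(z) = (u0/2)‖z‖² + u0⟨z, e⟩ + u1` with `u0 < 0`, `ω² = −u0/K`, the translated
hyperbolic trajectory
`z*(t) = (z̃T sinh(ω(t−t0)) + z̃0 sinh(ω(T−t))) / sinh(ω(T−t0)) − e`, where
`z̃0 = z0 + e`, `z̃T = zT + e`, is twice continuously differentiable, satisfies the
prescribed endpoints, and satisfies the Euler–Lagrange equation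
`K z*'' = −∇u(z*) = −u0 (z* + e)`. -/
theorem single_phase_affine_potential_trajectory
    (t0 T K u0 u1 ω : ℝ) (ht : t0 < T) (hK : 0 < K) (hu0 : u0 < 0)
    (hω : 0 < ω) (hω2 : ω ^ 2 = -u0 / K)
    (e z0 zT : EuclideanSpace ℝ (Fin 2))
    (u : EuclideanSpace ℝ (Fin 2) → ℝ)
    (hu : u = fun w => u0 / 2 * ‖w‖ ^ 2 + u0 * ⟪w, e⟫ + u1)
    (zstar : ℝ → EuclideanSpace ℝ (Fin 2))
    (hzstar : zstar = fun t =>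
      (Real.sinh (ω * (T - t0)))⁻¹ •
        (Real.sinh (ω * (t - t0)) • (zT + e) + Real.sinh (ω * (T - t)) • (z0 + e)) - e) :
    ContDiff ℝ 2 zstar ∧
    zstar t0 = z0 ∧ zstar T = zT ∧
    (∀ t ∈ Set.Icc t0 T,
      K • deriv (deriv zstar) t = (-u0) • (zstar t + e) ∧
      gradient u (zstar t) = u0 • (zstar t + e)) := by
  subst hu hzstar
  have hS : Real.sinh (ω * (T - t0)) ≠ 0 :=
    (Real.sinh_pos_iff.mpr (mul_pos hω (sub_pos.mpr ht))).ne'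
  have hKω : K * ω ^ 2 = -u0 := by rw [hω2, mul_div_cancel₀ _ hK.ne']
  refine ⟨contDiff_sinh_interpolation .., ?_, ?_, fun t _ => ⟨?_, ?_⟩⟩
  · simp [smul_smul, hS]
  · simp [smul_smul, hS]
  · rw [deriv_deriv_sinh_interpolation, smul_smul, hKω, sub_add_cancel]
  · exact (hasGradientAt_quadratic_add_linear ..).gradient
end

section
/- Let t0 be fixed, K > 0, ω > 0, and z0, zT ∈ ℝ². For T > t0 define S(T) = (Kω / (2 sinh(ω(T − t0)))) · ( (‖z0‖² + ‖zT‖²) cosh(ω(T − t0)) − 2⟨z0, zT⟩ ) and a_T = ω(zT cosh(ω(T − t0)) − z0) / sinh(ω(T − t0)). Then for every T > t0, dS/dT = −( (K/2)‖a_T‖² − (Kω²/2)‖zT‖² ); that is, the derivative of the optimal cost with respect to the final time equals minus the Hamiltonian H(zT, p*(T)) = ‖p*(T)‖²/(2K) − (Kω²/2)‖zT‖² evaluated at the final point, where p*(T) = K a_T is the terminal impulsion. -/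
open Real
open scoped RealInnerProductSpace

/-- forward Hamilton–Jacobi for the hot spot case: the derivative of the
closed-form optimal cost with respect to the final time equals minus the Hamiltonian at
the final point: `dS/dT = −((K/2)‖a_T‖² − (Kω²/2)‖zT‖²)`, where
`a_T = ω(zT cosh(ω(T−t0)) − z0)/sinh(ω(T−t0))` is the terminal velocity. -/
theorem hamilton_jacobi_forward_hotspot
    (t0 K ω : ℝ) (hK : 0 < K) (hω : 0 < ω)
    (z0 zT : EuclideanSpace ℝ (Fin 2))
    (S : ℝ → ℝ)
    (hS : S = fun T => K * ω / (2 * Real.sinh (ω * (T - t0))) *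
      ((‖z0‖ ^ 2 + ‖zT‖ ^ 2) * Real.cosh (ω * (T - t0)) - 2 * ⟪z0, zT⟫))
    (a : ℝ → EuclideanSpace ℝ (Fin 2))
    (ha : a = fun T => (ω / Real.sinh (ω * (T - t0))) •
      (Real.cosh (ω * (T - t0)) • zT - z0)) :
    ∀ T : ℝ, t0 < T →
      HasDerivAt S (-(K / 2 * ‖a T‖ ^ 2 - K * ω ^ 2 / 2 * ‖zT‖ ^ 2)) T := by
  intro T hT
  have hs : Real.sinh (ω * (T - t0)) ≠ 0 :=
    (Real.sinh_pos_iff.2 (mul_pos hω (sub_pos.2 hT))).ne'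
  have hlin : HasDerivAt (fun T : ℝ => ω * (T - t0)) ω T := by
    simpa using ((hasDerivAt_id T).sub_const t0).const_mul ω
  have hderiv := ((hasDerivAt_const T (K * ω)).div (hlin.sinh.const_mul 2)
    (mul_ne_zero two_ne_zero hs)).mul
    ((hlin.cosh.const_mul (‖z0‖ ^ 2 + ‖zT‖ ^ 2)).sub_const (2 * ⟪z0, zT⟫))
  have hnorm : ‖a T‖ ^ 2 = (ω / Real.sinh (ω * (T - t0))) ^ 2 *
      (Real.cosh (ω * (T - t0)) ^ 2 * ‖zT‖ ^ 2
        - 2 * Real.cosh (ω * (T - t0)) * ⟪z0, zT⟫ + ‖z0‖ ^ 2) := by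
    rw [ha, norm_smul, mul_pow, norm_sub_sq_real, norm_smul, mul_pow, real_inner_smul_left,
      real_inner_comm, Real.norm_eq_abs, Real.norm_eq_abs, sq_abs, sq_abs]
    ring
  rw [hS, hnorm]
  refine hderiv.congr_deriv ?_
  simp only [Pi.div_apply]
  have hcosh := Real.cosh_sq (ω * (T - t0))
  generalize Real.sinh (ω * (T - t0)) = s at *
  generalize Real.cosh (ω * (T - t0)) = c at *
  field_simp
  linear_combination (-(K * ω ^ 2 * ‖z0‖ ^ 2)) * hcosh
end

section
/- Let T be fixed, K > 0, ω > 0, and z0, zT ∈ ℝ². For t0 < T define S(t0) = (Kω / (2 sinh(ω(T − t0)))) · ( (‖z0‖² + ‖zT‖²) cosh(ω(T − t0)) − 2⟨z0, zT⟩ ) and a_{t0} = ω(zT − z0 cosh(ω(T − t0))) / sinh(ω(T − t0)). Then for every t0 < T, dS/dt0 = (K/2)‖a_{t0}‖² − (Kω²/2)‖z0‖²; that is, the derivative of the optimal cost with respect to the initial time equals the Hamiltonian H(z0, −p*(t0)) = ‖p*(t0)‖²/(2K) − (Kω²/2)‖z0‖² evaluated at the initial point, where p*(t0) = K a_{t0}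 is the initial impulsion. -/
open Real
open scoped RealInnerProductSpace

/-- backward Hamilton–Jacobi for the hot spot case: the derivative of
the closed-form optimal cost with respect to the initial time equals the Hamiltonian at
the initial point: `dS/dt0 = (K/2)‖a_{t0}‖² − (Kω²/2)‖z0‖²`, where
`a_{t0} = ω(zT − z0 cosh(ω(T−t0)))/sinh(ω(T−t0))` is the initial velocity. -/
theorem hamilton_jacobi_backward_hotspot
    (T K ω : ℝ) (hK : 0 < K) (hω : 0 < ω)
    (z0 zT : EuclideanSpace ℝ (Fin 2))
    (S : ℝ → ℝ)
    (hS : S = fun t0 => K * ω / (2 * Real.sinh (ω * (T - t0))) *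
      ((‖z0‖ ^ 2 + ‖zT‖ ^ 2) * Real.cosh (ω * (T - t0)) - 2 * ⟪z0, zT⟫))
    (a : ℝ → EuclideanSpace ℝ (Fin 2))
    (ha : a = fun t0 => (ω / Real.sinh (ω * (T - t0))) •
      (zT - Real.cosh (ω * (T - t0)) • z0)) :
    ∀ t0 : ℝ, t0 < T →
      HasDerivAt S (K / 2 * ‖a t0‖ ^ 2 - K * ω ^ 2 / 2 * ‖z0‖ ^ 2) t0 := by
  intro t0 ht
  subst hS ha
  have hs : Real.sinh (ω * (T - t0)) ≠ 0 :=
    (Real.sinh_pos_iff.mpr (mul_pos hω (sub_pos.mpr ht))).ne'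
  have hu : HasDerivAt (fun t : ℝ => ω * (T - t)) (-ω) t0 := by
    simpa using ((hasDerivAt_id t0).const_sub T).const_mul ω
  have hnum := (hu.cosh.const_mul (‖z0‖ ^ 2 + ‖zT‖ ^ 2)).sub_const (2 * ⟪z0, zT⟫)
  have hfactor := (hasDerivAt_const t0 (K * ω)).fun_div (hu.sinh.const_mul 2)
    (mul_ne_zero two_ne_zero hs)
  have hnorm : ‖zT - Real.cosh (ω * (T - t0)) • z0‖ ^ 2 =
      ‖zT‖ ^ 2 - 2 * Real.cosh (ω * (T - t0)) * ⟪z0, zT⟫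
        + Real.cosh (ω * (T - t0)) ^ 2 * ‖z0‖ ^ 2 := by
    rw [norm_sub_sq_real, norm_smul, mul_pow, Real.norm_eq_abs, sq_abs, real_inner_smul_right,
      real_inner_comm]
    ring
  refine (hfactor.fun_mul hnum).congr_deriv ?_
  simp only [norm_smul, mul_pow, Real.norm_eq_abs, sq_abs, hnorm]
  have hc := Real.cosh_sq (ω * (T - t0))
  generalize Real.cosh (ω * (T - t0)) = c at *
  generalize Real.sinh (ω * (T - t0)) = s at *
  field_simp
  linear_combination K * ω ^ 2 * ‖zT‖ ^ 2 * hc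
end

section
/- Let t0 < T, K > 0, ω1 > 0, ω2 > 0, u11, u12 ∈ ℝ, z0, zT, z_{h1}, z_{h2}, ξ ∈ ℝ². For τ ∈ (t0, T) define F(τ) = S1(τ) + S2(τ), where S1(τ) = (Kω1 / (2 sinh(ω1(τ − t0)))) · ( (‖z0 − z_{h1}‖² + ‖ξ − z_{h1}‖²) cosh(ω1(τ − t0)) − 2⟨z0 − z_{h1}, ξ − z_{h1}⟩ ) − u11(τ − t0) and S2(τ) = (Kω2 / (2 sinh(ω2(T − τ)))) · ( (‖ξ − z_{h2}‖² + ‖zT − z_{h2}‖²) cosh(ω2(T − τ)) − 2⟨ξ − z_{h2}, zT − z_{h2}⟩ ) − u12(T − τ). Define a1(τ) = ω1( (ξ − z_{h1}) cosh(ω1(τ − t0)) − (z0 − z_{h1}) ) / sinh(ω1(τ − t0)) and a2(τ) = ω2( (zT − z_{h2}) − (ξ − z_{h2}) cosh(ω2(T − τ)) ) / sinh(ω2(T − τ)). Then for every τ ∈ (t0, T), F'(τ) = H2(τ) − H1(τ) where H_i(τ) = (K/2)‖a_i(τ)‖² − (Kω_i²/2)‖ξ − z_{hi}‖² + u_{1i}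 for i = 1, 2. Consequently, τ is a stationary point of F if and only if H1(τ) = H2(τ). -/
open Real
open scoped RealInnerProductSpace

/-- The cost of an optimal arc of duration `s` between the displacements `p` and `q` from a hot
spot has derivative minus the energy, evaluated at the endpoint `q`. -/
theorem hasDerivAt_arc_cost {E : Type*} [NormedAddCommGroup E] [InnerProductSpace ℝ E]
    (K ω u : ℝ) (p q : E) {s : ℝ} (hs : Real.sinh (ω * s) ≠ 0) :
    HasDerivAt (fun s => K * ω / (2 * Real.sinh (ω * s)) *
        ((‖p‖ ^ 2 + ‖q‖ ^ 2) * Real.cosh (ω * s) - 2 * ⟪p, q⟫) - u * s)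
      (-(K / 2 * ‖(ω / Real.sinh (ω * s)) • (Real.cosh (ω * s) • q - p)‖ ^ 2 -
        K * ω ^ 2 / 2 * ‖q‖ ^ 2 + u)) s := by
  have hlin : HasDerivAt (fun s => ω * s) ω s := by
    simpa using (hasDerivAt_id s).const_mul ω
  have hcost := (((hasDerivAt_const s (K * ω)).fun_div (hlin.sinh.const_mul 2)
    (mul_ne_zero two_ne_zero hs)).fun_mul
    ((hlin.cosh.const_mul (‖p‖ ^ 2 + ‖q‖ ^ 2)).sub_const (2 * ⟪p, q⟫))).fun_sub
    ((hasDerivAt_id' s).const_mul u)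
  refine hcost.congr_deriv ?_
  have hnorm : ‖(ω / Real.sinh (ω * s)) • (Real.cosh (ω * s) • q - p)‖ ^ 2 =
      (ω / Real.sinh (ω * s)) ^ 2 *
        (Real.cosh (ω * s) ^ 2 * ‖q‖ ^ 2 - 2 * (Real.cosh (ω * s) * ⟪p, q⟫) + ‖p‖ ^ 2) := by
    rw [norm_smul, mul_pow, norm_sub_sq_real, norm_smul, mul_pow, real_inner_smul_left,
      real_inner_comm, Real.norm_eq_abs, Real.norm_eq_abs, sq_abs, sq_abs]
  rw [hnorm]
  have hcs := Real.cosh_sq (ω * s)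
  generalize Real.cosh (ω * s) = c at *
  generalize Real.sinh (ω * s) = d at *
  field_simp
  linear_combination -(K * ω ^ 2 * ‖p‖ ^ 2) * hcs

/-- optimality of the crossing time, first condition of Theorem 2:
in the bi-phase hot spot setting, the derivative of the total cost
`F(τ) = S1(τ) + S2(τ)` with respect to the interface crossing time `τ` equals
`H2(τ) − H1(τ)`, the difference of the Hamiltonians just after and just before the
crossing; hence `τ` is a stationary point of `F` iff the energy is conserved,
`H1(τ) = H2(τ)`. -/
theorem crossing_time_stationarity
    (t0 T K ω1 ω2 u11 u12 : ℝ) (ht : t0 < T) (hK : 0 < K)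
    (hω1 : 0 < ω1) (hω2 : 0 < ω2)
    (z0 zT zh1 zh2 ξ : EuclideanSpace ℝ (Fin 2))
    (S1 S2 F : ℝ → ℝ)
    (hS1 : S1 = fun τ => K * ω1 / (2 * Real.sinh (ω1 * (τ - t0))) *
      ((‖z0 - zh1‖ ^ 2 + ‖ξ - zh1‖ ^ 2) * Real.cosh (ω1 * (τ - t0)) -
        2 * ⟪z0 - zh1, ξ - zh1⟫) - u11 * (τ - t0))
    (hS2 : S2 = fun τ => K * ω2 / (2 * Real.sinh (ω2 * (T - τ))) *
      ((‖ξ - zh2‖ ^ 2 + ‖zT - zh2‖ ^ 2) * Real.cosh (ω2 * (T - τ)) -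
        2 * ⟪ξ - zh2, zT - zh2⟫) - u12 * (T - τ))
    (hF : F = fun τ => S1 τ + S2 τ)
    (a1 a2 : ℝ → EuclideanSpace ℝ (Fin 2))
    (ha1 : a1 = fun τ => (ω1 / Real.sinh (ω1 * (τ - t0))) •
      (Real.cosh (ω1 * (τ - t0)) • (ξ - zh1) - (z0 - zh1)))
    (ha2 : a2 = fun τ => (ω2 / Real.sinh (ω2 * (T - τ))) •
      ((zT - zh2) - Real.cosh (ω2 * (T - τ)) • (ξ - zh2)))
    (H1 H2 : ℝ → ℝ)
    (hH1 : H1 = fun τ => K / 2 * ‖a1 τ‖ ^ 2 - K * ω1 ^ 2 / 2 * ‖ξ - zh1‖ ^ 2 + u11)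
    (hH2 : H2 = fun τ => K / 2 * ‖a2 τ‖ ^ 2 - K * ω2 ^ 2 / 2 * ‖ξ - zh2‖ ^ 2 + u12) :
    ∀ τ ∈ Set.Ioo t0 T,
      HasDerivAt F (H2 τ - H1 τ) τ ∧ (deriv F τ = 0 ↔ H1 τ = H2 τ) := by
  rintro τ ⟨hτ0, hτT⟩
  have hs1 : Real.sinh (ω1 * (τ - t0)) ≠ 0 :=
    (Real.sinh_pos_iff.2 (mul_pos hω1 (sub_pos.2 hτ0))).ne'
  have hs2 : Real.sinh (ω2 * (T - τ)) ≠ 0 :=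
    (Real.sinh_pos_iff.2 (mul_pos hω2 (sub_pos.2 hτT))).ne'
  have hd1 : HasDerivAt S1 (-H1 τ) τ := by
    subst hS1 hH1 ha1
    exact (hasDerivAt_arc_cost K ω1 u11 (z0 - zh1) (ξ - zh1) hs1).comp_sub_const τ t0
  have hd2 : HasDerivAt S2 (H2 τ) τ := by
    subst hS2 hH2 ha2
    have h := (hasDerivAt_arc_cost K ω2 u12 (zT - zh2) (ξ - zh2) hs2).comp_const_sub T τ
    rw [neg_neg, ← norm_neg (_ • _), ← smul_neg, neg_sub] at h
    simpa only [add_comm (‖zT - zh2‖ ^ 2), real_inner_comm] using h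
  have hd : HasDerivAt F (H2 τ - H1 τ) τ := by
    rw [hF]
    exact (hd1.fun_add hd2).congr_deriv (by ring)
  exact ⟨hd, by rw [hd.deriv, sub_eq_zero, eq_comm]⟩
end
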